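/- arXiv:1211.5476 — 2 statements merged into one kernel-verified Lean document; each statement's English description precedes it below -/
import Mathlib

section
/- Let φ: ℝ³ → ℂ² be smooth with compact support in ℝ³∖{0}. Then ∫_{ℝ³} |x| |∂_r φ(x)|² dx ≤ ∫_{ℝ³} |x| |(σ·∇)φ(x)|² dx, where σ·∇ = σ₁∂₁ + σ₂∂₂ + σ₃∂₃ with σ₁, σ₂, σ₃ the Pauli matrices, and ∂_r = (x/|x|)·∇ is the radial derivative. -/
noncomputable section
open MeasureTheory Matrix Finset

abbrev E3 := EuclideanSpace ℝ (Fin 3)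

/-- The Pauli matrices. -/
def pauli : Fin 3 → Matrix (Fin 2) (Fin 2) ℂ :=
  ![!![0, 1; 1, 0], !![0, -Complex.I; Complex.I, 0], !![1, 0; 0, -1]]

/-- `σ · a` for a real vector `a`. -/
def sigmaDot (a : Fin 3 → ℝ) : Matrix (Fin 2) (Fin 2) ℂ :=
  ∑ k, (a k : ℂ) • pauli k

/-- `(σ · ∇)φ` for a `ℂ²`-valued function. -/
def sigmaGrad (φ : E3 → Fin 2 → ℂ) (x : E3) : Fin 2 → ℂ :=
  ∑ k, (pauli k).mulVec (fderiv ℝ φ x (EuclideanSpace.single k 1))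

/-- The radial derivative `∂_r φ(x) = (x/|x|)·∇φ(x)`. -/
def radialDeriv {F : Type*} [NormedAddCommGroup F] [NormedSpace ℝ F]
    (φ : E3 → F) (x : E3) : F := fderiv ℝ φ x (‖x‖⁻¹ • x)

/-- The Dirac matrices `α_k` in block form. -/
def diracAlpha (k : Fin 3) : Matrix (Fin 4) (Fin 4) ℂ :=
  Matrix.reindex finSumFinEquiv finSumFinEquiv ((Matrix.fromBlocks 0 (pauli k) (pauli k) 0 : Matrix (Fin 2 ⊕ Fin 2) (Fin 2 ⊕ Fin 2) ℂ))

/-- The Dirac matrix `β` in block form. -/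
def diracBeta : Matrix (Fin 4) (Fin 4) ℂ :=
  Matrix.reindex finSumFinEquiv finSumFinEquiv ((Matrix.fromBlocks 1 0 0 (-1) : Matrix (Fin 2 ⊕ Fin 2) (Fin 2 ⊕ Fin 2) ℂ))

/-- `(α · ∇)ψ` for a `ℂ⁴`-valued function. -/
def alphaGrad (ψ : E3 → Fin 4 → ℂ) (x : E3) : Fin 4 → ℂ :=
  ∑ k, (diracAlpha k).mulVec (fderiv ℝ ψ x (EuclideanSpace.single k 1))


/-- The `k`-th partial derivative of a real-valued function. -/
def partialDeriv (k : Fin 3) (f : E3 → ℝ) (x : E3) : ℝ :=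
  fderiv ℝ f x (EuclideanSpace.single k 1)

/-- The `k`-th component of `∇f × ∇g`. -/
def gradCross (k : Fin 3) (f g : E3 → ℝ) (x : E3) : ℝ :=
  partialDeriv (k + 1) f x * partialDeriv (k + 2) g x -
    partialDeriv (k + 2) f x * partialDeriv (k + 1) g x

/-- The Jacobian determinant `∇h · (∇f × ∇g)`. -/
def jacobian (h f g : E3 → ℝ) (x : E3) : ℝ :=
  ∑ k, partialDeriv k h x * gradCross k f g x

lemma partialDeriv_of_notMem_tsupport {f : E3 → ℝ} {x : E3} (hx : x ∉ tsupport f) (k : Fin 3) :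
    partialDeriv k f x = 0 := by
  rw [partialDeriv, fderiv_of_notMem_tsupport (𝕜 := ℝ) hx, _root_.zero_apply]

lemma gradCross_of_notMem_tsupport {f : E3 → ℝ} {x : E3} (hx : x ∉ tsupport f) (k : Fin 3)
    (g : E3 → ℝ) : gradCross k f g x = 0 := by
  simp [gradCross, partialDeriv_of_notMem_tsupport hx]

lemma contDiff_partialDeriv {f : E3 → ℝ} (hf : ContDiff ℝ 2 f) (k : Fin 3) :
    ContDiff ℝ 1 (partialDeriv k f) :=
  (hf.fderiv_right (m := 1) (by norm_num)).clm_apply contDiff_const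

lemma contDiff_gradCross {f g : E3 → ℝ} (hf : ContDiff ℝ 2 f) (hg : ContDiff ℝ 2 g) (k : Fin 3) :
    ContDiff ℝ 1 (gradCross k f g) :=
  ((contDiff_partialDeriv hf _).mul (contDiff_partialDeriv hg _)).sub
    ((contDiff_partialDeriv hf _).mul (contDiff_partialDeriv hg _))

lemma partialDeriv_comm {f : E3 → ℝ} (hf : ContDiff ℝ 2 f) (j k : Fin 3) (x : E3) :
    partialDeriv j (partialDeriv k f) x = partialDeriv k (partialDeriv j f) x := by
  have hd : DifferentiableAt ℝ (fderiv ℝ f) x :=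
    (hf.fderiv_right (m := 1) (by norm_num)).differentiable (by norm_num) x
  have key (i l : Fin 3) : partialDeriv i (partialDeriv l f) x =
      fderiv ℝ (fderiv ℝ f) x (EuclideanSpace.single i 1) (EuclideanSpace.single l 1) := by
    have := hd.hasFDerivAt.clm_apply
      (hasFDerivAt_const (EuclideanSpace.single l (1 : ℝ)) x)
    change fderiv ℝ (fun y => fderiv ℝ f y (EuclideanSpace.single l 1)) x _ = _
    rw [this.fderiv]
    simp
  rw [key, key]
  exact hf.contDiffAt.isSymmSndFDerivAt (by simp) _ _

lemma partialDeriv_mul {f g : E3 → ℝ} {x : E3} (hf : DifferentiableAt ℝ f x)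
    (hg : DifferentiableAt ℝ g x) (k : Fin 3) :
    partialDeriv k (fun y => f y * g y) x =
      f x * partialDeriv k g x + partialDeriv k f x * g x := by
  rw [partialDeriv, fderiv_fun_mul hf hg]
  simp [partialDeriv, mul_comm]

lemma partialDeriv_sub {f g : E3 → ℝ} {x : E3} (hf : DifferentiableAt ℝ f x)
    (hg : DifferentiableAt ℝ g x) (k : Fin 3) :
    partialDeriv k (fun y => f y - g y) x = partialDeriv k f x - partialDeriv k g x := by
  rw [partialDeriv, fderiv_fun_sub hf hg]
  simp [partialDeriv]

/-- `∇f × ∇g` is divergence free. -/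
lemma sum_partialDeriv_gradCross {f g : E3 → ℝ} (hf : ContDiff ℝ 2 f) (hg : ContDiff ℝ 2 g)
    (x : E3) : ∑ k, partialDeriv k (gradCross k f g) x = 0 := by
  have df (k : Fin 3) : DifferentiableAt ℝ (partialDeriv k f) x :=
    (contDiff_partialDeriv hf k).differentiable one_ne_zero x
  have dg (k : Fin 3) : DifferentiableAt ℝ (partialDeriv k g) x :=
    (contDiff_partialDeriv hg k).differentiable one_ne_zero x
  have key (k : Fin 3) : partialDeriv k (gradCross k f g) x = _ :=
    partialDeriv_sub ((df (k + 1)).fun_mul (dg (k + 2))) ((df (k + 2)).fun_mul (dg (k + 1))) k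
  simp only [key, partialDeriv_mul (df _) (dg _), Fin.sum_univ_three, Fin.isValue,
    show (0 : Fin 3) + 1 = 1 from rfl, show (0 : Fin 3) + 2 = 2 from rfl,
    show (1 : Fin 3) + 1 = 2 from rfl, show (1 : Fin 3) + 2 = 0 from rfl,
    show (2 : Fin 3) + 1 = 0 from rfl, show (2 : Fin 3) + 2 = 1 from rfl]
  rw [partialDeriv_comm hf 1 0, partialDeriv_comm hf 2 0, partialDeriv_comm hf 2 1,
    partialDeriv_comm hg 1 0, partialDeriv_comm hg 2 0, partialDeriv_comm hg 2 1]
  ring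

lemma integral_partialDeriv_eq_zero {f : E3 → ℝ} (hf : ContDiff ℝ 1 f) (hc : HasCompactSupport f)
    (k : Fin 3) :
    Integrable (partialDeriv k f) ∧ ∫ x, partialDeriv k f x = 0 := by
  have hi : Integrable (partialDeriv k f) :=
    ((hf.continuous_fderiv one_ne_zero).clm_apply continuous_const).integrable_of_hasCompactSupport
      (hc.fderiv_apply (𝕜 := ℝ) _)
  refine ⟨hi, ?_⟩
  have := integral_mul_fderiv_eq_neg_fderiv_mul_of_integrable (μ := volume) (f := fun _ : E3 => (1 : ℝ))
    (g := f) (v := EuclideanSpace.single k 1) (by simp) (by simpa using! hi)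
    (by simpa using hf.continuous.integrable_of_hasCompactSupport hc)
    (fun x _ => differentiableAt_const _) (fun x _ => hf.differentiable one_ne_zero x)
  simpa [partialDeriv] using this

/-- The Jacobian determinant is a null Lagrangian. -/
lemma integral_jacobian_eq_zero {h f g : E3 → ℝ} (hf : ContDiff ℝ 2 f) (hg : ContDiff ℝ 2 g)
    (hc : HasCompactSupport f) (hh : ∀ x ∈ tsupport f, ContDiffAt ℝ 1 h x) :
    Integrable (jacobian h f g) ∧ ∫ x, jacobian h f g x = 0 := by
  have hsupp (k : Fin 3) {x : E3} (hx : x ∉ tsupport f) :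
      (fun y => h y * gradCross k f g y) =ᶠ[nhds x] fun _ => 0 := by
    filter_upwards [(isClosed_tsupport f).isOpen_compl.mem_nhds hx] with y hy
    rw [gradCross_of_notMem_tsupport hy, mul_zero]
  have hsmooth (k : Fin 3) : ContDiff ℝ 1 (fun y => h y * gradCross k f g y) := by
    rw [contDiff_iff_contDiffAt]
    intro x
    by_cases hx : x ∈ tsupport f
    · exact (hh x hx).mul (contDiff_gradCross hf hg k).contDiffAt
    · exact contDiffAt_const.congr_of_eventuallyEq (hsupp k hx)
  have hcpt (k : Fin 3) : HasCompactSupport (fun y => h y * gradCross k f g y) :=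
    hc.mono' fun x hx => by
      by_contra hx'
      exact hx (by simp [gradCross_of_notMem_tsupport hx'])
  have hdiv : jacobian h f g =
      fun x => ∑ k, partialDeriv k (fun y => h y * gradCross k f g y) x := by
    ext x
    by_cases hx : x ∈ tsupport f
    · simp only [partialDeriv_mul ((hh x hx).differentiableAt one_ne_zero)
        ((contDiff_gradCross hf hg _).differentiable one_ne_zero x), sum_add_distrib,
        ← mul_sum, sum_partialDeriv_gradCross hf hg, jacobian, mul_zero, zero_add]
    · refine sum_congr rfl fun k _ => ?_
      rw [gradCross_of_notMem_tsupport hx, partialDeriv, partialDeriv, (hsupp k hx).fderiv_eq]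
      simp
  have key (k : Fin 3) := integral_partialDeriv_eq_zero (hsmooth k) (hcpt k) k
  rw [hdiv]
  exact ⟨integrable_finsetSum _ fun k _ => (key k).1, by
    rw [integral_finsetSum _ fun k _ => (key k).1]
    exact sum_eq_zero fun k _ => (key k).2⟩

set_option maxHeartbeats 2000000 in
/-- Pointwise positivity: with `a + ib, c + id` the components of the spinor gradient at
`(x, y, z)`, the expression times `2 r²` is `∑ₖ |r² ∇ₖφ - xₖ (x · ∇)φ + i (σ · x) (x × ∇)ₖ φ|²`. -/
lemma spinor_gradient_nonneg (x y z a1 a2 a3 b1 b2 b3 c1 c2 c3 d1 d2 d3 r : ℝ)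
    (hr : r ^ 2 = x ^ 2 + y ^ 2 + z ^ 2) (h0 : 0 < r) :
    0 ≤ r ^ 2 * ((c1 + d2 + a3) ^ 2 + (d1 - c2 + b3) ^ 2 + (a1 - b2 - c3) ^ 2 + (b1 + a2 - d3) ^ 2)
    - ((x*a1+y*a2+z*a3) ^ 2 + (x*b1+y*b2+z*b3) ^ 2 + (x*c1+y*c2+z*c3) ^ 2 + (x*d1+y*d2+z*d3) ^ 2)
    - 2 * (-(r ^ 2*(a1*b2-a2*b1) + z*(x*(a2*b3-a3*b2)+y*(a3*b1-a1*b3)+z*(a1*b2-a2*b1)))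
      + (r ^ 2*(c1*d2-c2*d1) + z*(x*(c2*d3-c3*d2)+y*(c3*d1-c1*d3)+z*(c1*d2-c2*d1)))
      - (r ^ 2*(a2*d3-a3*d2) + x*(x*(a2*d3-a3*d2)+y*(a3*d1-a1*d3)+z*(a1*d2-a2*d1)))
      + (r ^ 2*(b2*c3-b3*c2) + x*(x*(b2*c3-b3*c2)+y*(b3*c1-b1*c3)+z*(b1*c2-b2*c1)))
      + (r ^ 2*(a3*c1-a1*c3) + y*(x*(a2*c3-a3*c2)+y*(a3*c1-a1*c3)+z*(a1*c2-a2*c1)))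
      + (r ^ 2*(b3*d1-b1*d3) + y*(x*(b2*d3-b3*d2)+y*(b3*d1-b1*d3)+z*(b1*d2-b2*d1)))) := by
  have h2 : 0 < 2 * r ^ 2 := by positivity
  refine nonneg_of_mul_nonneg_right (a := 2 * r ^ 2) ?_ h2
  rw [hr]
  have key : ∀ E : ℝ, E = ((x ^ 2 + y ^ 2 + z ^ 2) * a1 - x * (x * a1 + y * a2 + z * a3)
        + (-(z * (y * b3 - z * b2) + x * (y * d3 - z * d2) - y * (y * c3 - z * c2)))) ^ 2
      + ((x ^ 2 + y ^ 2 + z ^ 2) * b1 - x * (x * b1 + y * b2 + z * b3)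
        + ((z * (y * a3 - z * a2) + x * (y * c3 - z * c2) + y * (y * d3 - z * d2)))) ^ 2
      + ((x ^ 2 + y ^ 2 + z ^ 2) * c1 - x * (x * c1 + y * c2 + z * c3)
        + (-(x * (y * b3 - z * b2) + y * (y * a3 - z * a2) - z * (y * d3 - z * d2)))) ^ 2
      + ((x ^ 2 + y ^ 2 + z ^ 2) * d1 - x * (x * d1 + y * d2 + z * d3)
        + ((x * (y * a3 - z * a2) - y * (y * b3 - z * b2) - z * (y * c3 - z * c2)))) ^ 2
      + ((x ^ 2 + y ^ 2 + z ^ 2) * a2 - y * (x * a1 + y * a2 + z * a3)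
        + (-(z * (z * b1 - x * b3) + x * (z * d1 - x * d3) - y * (z * c1 - x * c3)))) ^ 2
      + ((x ^ 2 + y ^ 2 + z ^ 2) * b2 - y * (x * b1 + y * b2 + z * b3)
        + ((z * (z * a1 - x * a3) + x * (z * c1 - x * c3) + y * (z * d1 - x * d3)))) ^ 2
      + ((x ^ 2 + y ^ 2 + z ^ 2) * c2 - y * (x * c1 + y * c2 + z * c3)
        + (-(x * (z * b1 - x * b3) + y * (z * a1 - x * a3) - z * (z * d1 - x * d3)))) ^ 2
      + ((x ^ 2 + y ^ 2 + z ^ 2) * d2 - y * (x * d1 + y * d2 + z * d3)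
        + ((x * (z * a1 - x * a3) - y * (z * b1 - x * b3) - z * (z * c1 - x * c3)))) ^ 2
      + ((x ^ 2 + y ^ 2 + z ^ 2) * a3 - z * (x * a1 + y * a2 + z * a3)
        + (-(z * (x * b2 - y * b1) + x * (x * d2 - y * d1) - y * (x * c2 - y * c1)))) ^ 2
      + ((x ^ 2 + y ^ 2 + z ^ 2) * b3 - z * (x * b1 + y * b2 + z * b3)
        + ((z * (x * a2 - y * a1) + x * (x * c2 - y * c1) + y * (x * d2 - y * d1)))) ^ 2
      + ((x ^ 2 + y ^ 2 + z ^ 2) * c3 - z * (x * c1 + y * c2 + z * c3)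
        + (-(x * (x * b2 - y * b1) + y * (x * a2 - y * a1) - z * (x * d2 - y * d1)))) ^ 2
      + ((x ^ 2 + y ^ 2 + z ^ 2) * d3 - z * (x * d1 + y * d2 + z * d3)
        + ((x * (x * a2 - y * a1) - y * (x * b2 - y * b1) - z * (x * c2 - y * c1)))) ^ 2 → 0 ≤ E := by
    rintro E rfl; positivity
  apply key
  ring

lemma contDiffAt_norm_mul_coord {x : E3} (hx : x ≠ 0) (l : Fin 3) :
    ContDiffAt ℝ 1 (fun y : E3 => ‖y‖ * y l) x :=
  (contDiffAt_norm ℝ hx).mul (EuclideanSpace.proj (𝕜 := ℝ) l).contDiff.contDiffAt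

lemma partialDeriv_norm {x : E3} (hx : x ≠ 0) (k : Fin 3) :
    partialDeriv k (fun y => ‖y‖) x = x k / ‖x‖ := by
  have h := (hasStrictFDerivAt_norm_sq x).hasFDerivAt.sqrt (by simpa using hx)
  simp only [Real.sqrt_sq (norm_nonneg _)] at h
  rw [partialDeriv, h.fderiv]
  simp [EuclideanSpace.inner_single_right]
  field_simp

lemma partialDeriv_norm_mul_coord {x : E3} (hx : x ≠ 0) (k l : Fin 3) :
    partialDeriv k (fun y => ‖y‖ * y l) x =
      ‖x‖ * (if l = k then 1 else 0) + x k / ‖x‖ * x l := by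
  have hl : partialDeriv k (fun y => y l) x = if l = k then 1 else 0 := by
    rw [partialDeriv, show (fun y : E3 => y l) = EuclideanSpace.proj (𝕜 := ℝ) l from rfl,
      ContinuousLinearMap.fderiv]
    simp
  rw [partialDeriv_mul (g := fun y => y l)
    ((contDiffAt_norm (n := 1) ℝ hx).differentiableAt one_ne_zero)
    (EuclideanSpace.proj (𝕜 := ℝ) l).differentiableAt, partialDeriv_norm hx, hl]

lemma jacobian_norm_mul_coord {x : E3} (hx : x ≠ 0) (l : Fin 3) (f g : E3 → ℝ) :
    ‖x‖ * jacobian (fun y => ‖y‖ * y l) f g x =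
      ‖x‖ ^ 2 * gradCross l f g x + x l * ∑ k, x k * gradCross k f g x := by
  have hr : ‖x‖ ≠ 0 := norm_ne_zero_iff.mpr hx
  simp only [jacobian, partialDeriv_norm_mul_coord hx, Fin.sum_univ_three]
  fin_cases l <;> simp <;> field_simp <;> ring

section Components

variable {φ : E3 → Fin 2 → ℂ}

lemma contDiff_re_im (hφ : ContDiff ℝ (⊤ : ℕ∞) φ) (i : Fin 2) :
    ContDiff ℝ 2 (fun x => (φ x i).re) ∧ ContDiff ℝ 2 (fun x => (φ x i).im) := by
  have h : ContDiff ℝ 2 (fun x => φ x i) := contDiff_pi.1 (contDiff_infty.1 hφ 2) i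
  exact ⟨Complex.reCLM.contDiff.comp h, Complex.imCLM.contDiff.comp h⟩

lemma partialDeriv_re_im (hφ : ContDiff ℝ (⊤ : ℕ∞) φ) (i : Fin 2) (k : Fin 3) (x : E3) :
    partialDeriv k (fun x => (φ x i).re) x = (fderiv ℝ φ x (EuclideanSpace.single k 1) i).re ∧
    partialDeriv k (fun x => (φ x i).im) x = (fderiv ℝ φ x (EuclideanSpace.single k 1) i).im := by
  have h := hasFDerivAt_pi'.1 (hφ.differentiable (by simp) x).hasFDerivAt i
  constructor
  · exact congrArg (· (EuclideanSpace.single k 1)) (Complex.reCLM.hasFDerivAt.comp x h).fderiv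
  · exact congrArg (· (EuclideanSpace.single k 1)) (Complex.imCLM.hasFDerivAt.comp x h).fderiv

lemma tsupport_re_im_subset (i : Fin 2) :
    tsupport (fun x => (φ x i).re) ⊆ tsupport φ ∧ tsupport (fun x => (φ x i).im) ⊆ tsupport φ := by
  constructor <;> refine closure_mono fun x hx hφ => hx ?_ <;> simp [hφ]

/-- The Jacobian terms arising from the cross terms in `|(σ · ∇)φ|²`. -/
def crossTerm (φ : E3 → Fin 2 → ℂ) (x : E3) : ℝ :=
  -jacobian (fun y => ‖y‖ * y 2) (fun x => (φ x 0).re) (fun x => (φ x 0).im) x +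
    jacobian (fun y => ‖y‖ * y 2) (fun x => (φ x 1).re) (fun x => (φ x 1).im) x +
    -jacobian (fun y => ‖y‖ * y 0) (fun x => (φ x 0).re) (fun x => (φ x 1).im) x +
    jacobian (fun y => ‖y‖ * y 0) (fun x => (φ x 0).im) (fun x => (φ x 1).re) x +
    jacobian (fun y => ‖y‖ * y 1) (fun x => (φ x 0).re) (fun x => (φ x 1).re) x +
    jacobian (fun y => ‖y‖ * y 1) (fun x => (φ x 0).im) (fun x => (φ x 1).im) x

lemma integral_crossTerm (hφ : ContDiff ℝ (⊤ : ℕ∞) φ) (hc : HasCompactSupport φ)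
    (h0 : (0 : E3) ∉ tsupport φ) :
    Integrable (crossTerm φ) ∧ ∫ x, crossTerm φ x = 0 := by
  have key (l : Fin 3) {f g : E3 → ℝ} (hf : ContDiff ℝ 2 f) (hg : ContDiff ℝ 2 g)
      (hs : tsupport f ⊆ tsupport φ) :=
    integral_jacobian_eq_zero (h := fun y => ‖y‖ * y l) hf hg
      (hc.of_isClosed_subset (isClosed_tsupport f) hs)
      fun x hx => contDiffAt_norm_mul_coord (fun h => h0 (h ▸ hs hx)) l
  have re (i : Fin 2) := (contDiff_re_im hφ i).1
  have im (i : Fin 2) := (contDiff_re_im hφ i).2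
  have sre (i : Fin 2) := (tsupport_re_im_subset (φ := φ) i).1
  have sim (i : Fin 2) := (tsupport_re_im_subset (φ := φ) i).2
  have hadd {f g : E3 → ℝ} (hf : Integrable f ∧ ∫ x, f x = 0) (hg : Integrable g ∧ ∫ x, g x = 0) :
      Integrable (f + g) ∧ ∫ x, (f + g) x = 0 :=
    ⟨hf.1.add hg.1, by rw [integral_add' hf.1 hg.1, hf.2, hg.2, add_zero]⟩
  have hneg {f : E3 → ℝ} (hf : Integrable f ∧ ∫ x, f x = 0) :
      Integrable (-f) ∧ ∫ x, (-f) x = 0 :=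
    ⟨hf.1.neg, by rw [integral_neg', hf.2, neg_zero]⟩
  exact hadd (hadd (hadd (hadd (hadd (hneg (key 2 (re 0) (im 0) (sre 0))) (key 2 (re 1) (im 1) (sre 1)))
    (hneg (key 0 (re 0) (im 1) (sre 0)))) (key 0 (im 0) (re 1) (sim 0)))
    (key 1 (re 0) (re 1) (sre 0))) (key 1 (im 0) (im 1) (sim 0))

lemma radialDeriv_eq_sum (x : E3) :
    radialDeriv φ x = ‖x‖⁻¹ • ∑ k, x k • fderiv ℝ φ x (EuclideanSpace.single k 1) := by
  have hx : x = ∑ k, x k • EuclideanSpace.single k (1 : ℝ) := by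
    ext j
    simp [Pi.single_apply]
  rw [radialDeriv, map_smul]
  nth_rw 3 [hx]
  simp only [map_sum, map_smul]

lemma radial_le_sigmaGrad_sub_crossTerm (hφ : ContDiff ℝ (⊤ : ℕ∞) φ) (h0 : (0 : E3) ∉ tsupport φ)
    (x : E3) :
    ‖x‖ * ∑ i, ‖radialDeriv φ x i‖ ^ 2 ≤
      ‖x‖ * ∑ i, ‖sigmaGrad φ x i‖ ^ 2 - 2 * crossTerm φ x := by
  by_cases hx : x ∈ tsupport φ
  · have hx0 : x ≠ 0 := fun h => h0 (h ▸ hx)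
    have hr : 0 < ‖x‖ := norm_pos_iff.mpr hx0
    refine le_of_mul_le_mul_left ?_ hr
    have hn : ‖x‖ ^ 2 = x 0 ^ 2 + x 1 ^ 2 + x 2 ^ 2 := by
      simp [EuclideanSpace.norm_sq_eq, Fin.sum_univ_three]
    have main := spinor_gradient_nonneg (x 0) (x 1) (x 2)
      (fderiv ℝ φ x (EuclideanSpace.single 0 1) 0).re (fderiv ℝ φ x (EuclideanSpace.single 1 1) 0).re
      (fderiv ℝ φ x (EuclideanSpace.single 2 1) 0).re
      (fderiv ℝ φ x (EuclideanSpace.single 0 1) 0).im (fderiv ℝ φ x (EuclideanSpace.single 1 1) 0).im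
      (fderiv ℝ φ x (EuclideanSpace.single 2 1) 0).im
      (fderiv ℝ φ x (EuclideanSpace.single 0 1) 1).re (fderiv ℝ φ x (EuclideanSpace.single 1 1) 1).re
      (fderiv ℝ φ x (EuclideanSpace.single 2 1) 1).re
      (fderiv ℝ φ x (EuclideanSpace.single 0 1) 1).im (fderiv ℝ φ x (EuclideanSpace.single 1 1) 1).im
      (fderiv ℝ φ x (EuclideanSpace.single 2 1) 1).im ‖x‖ hn hr
    have hrad : ‖x‖ * (‖x‖ * ∑ i, ‖radialDeriv φ x i‖ ^ 2) =
        ∑ i, ‖(∑ k, x k • fderiv ℝ φ x (EuclideanSpace.single k 1)) i‖ ^ 2 := by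
      rw [radialDeriv_eq_sum, ← mul_assoc, mul_sum]
      refine sum_congr rfl fun i _ => ?_
      rw [Pi.smul_apply, norm_smul, norm_inv, norm_norm]
      field_simp
    rw [hrad, mul_sub, mul_left_comm ‖x‖ 2]
    simp only [crossTerm, mul_add, mul_neg, jacobian_norm_mul_coord hx0]
    simp only [gradCross, (partialDeriv_re_im hφ _ _ _).1, (partialDeriv_re_im hφ _ _ _).2,
      Fin.sum_univ_three, Fin.isValue,
      show (0 : Fin 3) + 1 = 1 from rfl, show (0 : Fin 3) + 2 = 2 from rfl,
      show (1 : Fin 3) + 1 = 2 from rfl, show (1 : Fin 3) + 2 = 0 from rfl,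
      show (2 : Fin 3) + 1 = 0 from rfl, show (2 : Fin 3) + 2 = 1 from rfl]
    simp only [sigmaGrad, pauli, Fin.sum_univ_three, Fin.sum_univ_two, Complex.sq_norm,
      Complex.normSq_apply, Fin.isValue] at main ⊢
    simp [dotProduct, Fin.sum_univ_two]
    linarith
  · have hs {f : E3 → ℝ} (hf : tsupport f ⊆ tsupport φ) (h g : E3 → ℝ) : jacobian h f g x = 0 := by
      simp [jacobian, gradCross_of_notMem_tsupport fun hx' => hx (hf hx')]
    have hct : crossTerm φ x = 0 := by
      simp [crossTerm, hs (tsupport_re_im_subset _).1, hs (tsupport_re_im_subset _).2]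
    simp [hct, radialDeriv, fderiv_of_notMem_tsupport (𝕜 := ℝ) hx]
    positivity

lemma integrable_sigmaGrad (hφ : ContDiff ℝ (⊤ : ℕ∞) φ) (hc : HasCompactSupport φ) :
    Integrable fun x => ‖x‖ * ∑ i, ‖sigmaGrad φ x i‖ ^ 2 := by
  have hd : Continuous (fderiv ℝ φ) := hφ.continuous_fderiv (by simp)
  have hs : Continuous (sigmaGrad φ) :=
    continuous_finsetSum _ fun k _ => continuous_const.matrix_mulVec (hd.clm_apply continuous_const)
  refine Continuous.integrable_of_hasCompactSupport (by fun_prop) (hc.mono' fun x hx => ?_)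
  by_contra hx'
  exact hx (by simp [sigmaGrad, fderiv_of_notMem_tsupport (𝕜 := ℝ) hx'])

end Components

theorem stmt7 (φ : E3 → Fin 2 → ℂ) (hφ : ContDiff ℝ (⊤ : ℕ∞) φ) (hc : HasCompactSupport φ)
    (h0 : (0 : E3) ∉ tsupport φ) :
    (∫ x : E3, ‖x‖ * ∑ i, ‖radialDeriv φ x i‖ ^ 2) ≤
      ∫ x : E3, ‖x‖ * ∑ i, ‖sigmaGrad φ x i‖ ^ 2 := by

  obtain ⟨hi, he⟩ := integral_crossTerm hφ hc h0
  have hσ := integrable_sigmaGrad hφ hc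
  calc ∫ x : E3, ‖x‖ * ∑ i, ‖radialDeriv φ x i‖ ^ 2
      ≤ ∫ x : E3, (‖x‖ * ∑ i, ‖sigmaGrad φ x i‖ ^ 2 - 2 * crossTerm φ x) :=
        integral_mono_of_nonneg (.of_forall fun x => by positivity) (hσ.sub (hi.const_mul 2))
          (.of_forall (radial_le_sigmaGrad_sub_crossTerm hφ h0))
    _ = ∫ x : E3, ‖x‖ * ∑ i, ‖sigmaGrad φ x i‖ ^ 2 := by
        rw [integral_sub hσ (hi.const_mul 2), integral_const_mul, he, mul_zero, sub_zero]
end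
end

section
/- Hardy–Dirac inequality: for every smooth compactly supported ψ: ℝ³ → ℂ⁴, every m ≥ 0 and every ε > 0, ∫_{ℝ³} |ψ(x)|²/|x| dx ≤ ∫_{ℝ³} |x| |(i α·∇ ψ - m β ψ ± iε ψ)(x)|² dx, where α·∇ = α₁∂₁ + α₂∂₂ + α₃∂₃ with the Dirac matrices α_k and β. -/
noncomputable section
open MeasureTheory Matrix Finset

namespace HardyDirac
open scoped ComplexConjugate ContDiff Real
open Complex (I)

lemma fourierCoeffOn_deriv_of_periodic {w w' : ℝ → ℂ} (hw : ∀ t, HasDerivAt w (w' t) t)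
    (hc : Continuous w') (hper : w (2 * π) = w 0) (n : ℤ) :
    fourierCoeffOn Real.two_pi_pos w' n = I * n * fourierCoeffOn Real.two_pi_pos w n := by
  rcases eq_or_ne n 0 with rfl | hn
  · have h := intervalIntegral.integral_eq_sub_of_hasDerivAt (a := 0) (b := 2 * π)
      (fun t _ => hw t) (hc.intervalIntegrable _ _)
    simp [fourierCoeffOn_eq_integral, h, hper]
  · rw [fourierCoeffOn_of_hasDerivAt Real.two_pi_pos hn (fun t _ => hw t)
      (hc.intervalIntegrable _ _), hper]
    have h1 : (n : ℂ) ≠ 0 := by exact_mod_cast hn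
    have h2 : (π : ℂ) ≠ 0 := by exact_mod_cast Real.pi_ne_zero
    have h3 := Complex.I_ne_zero
    push_cast
    field_simp
    ring

lemma fourierCoeffOn_add {a b : ℝ} (hab : a < b) {f g : ℝ → ℂ} (hf : Continuous f)
    (hg : Continuous g) (n : ℤ) :
    fourierCoeffOn hab (fun t => f t + g t) n =
      fourierCoeffOn hab f n + fourierCoeffOn hab g n := by
  have : Continuous fun t : ℝ => fourier (-n) (t : AddCircle (b - a)) :=
    (map_continuous _).comp (AddCircle.continuous_mk' _)
  simp only [fourierCoeffOn_eq_integral, smul_eq_mul, mul_add]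
  rw [← smul_add, ← intervalIntegral.integral_add]
  exacts [(this.mul hf).intervalIntegrable _ _, (this.mul hg).intervalIntegrable _ _]

lemma memLp_two_of_continuous {f : ℝ → ℂ} (hf : Continuous f) (a b : ℝ) :
    MemLp f 2 (volume.restrict (Set.Ioc a b)) := by
  have : IsFiniteMeasure (volume.restrict (Set.Ioc a b)) := ⟨by simp⟩
  obtain ⟨C, hC⟩ := isCompact_Icc.exists_bound_of_continuousOn (s := Set.Icc a b) hf.continuousOn
  exact MemLp.of_bound hf.aestronglyMeasurable C
    ((ae_restrict_mem measurableSet_Ioc).mono fun t ht => hC t (Set.Ioc_subset_Icc_self ht))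

/-- Wirtinger's inequality for antiperiodic functions, in the form of a statement about periodic
ones: `-i d/dt + τ/2` has spectrum `ℤ + τ/2`. -/
lemma integral_sq_le_of_periodic {w w' : ℝ → ℂ} (hw : ∀ t, HasDerivAt w (w' t) t)
    (hc : Continuous w') (hper : w (2 * π) = w 0) {τ : ℝ} (hτ : τ = 1 ∨ τ = -1) :
    ∫ t in (0 : ℝ)..2 * π, ‖w t‖ ^ 2 ≤ ∫ t in (0 : ℝ)..2 * π, ‖2 * w' t + τ * I * w t‖ ^ 2 := by
  have hwc : Continuous w := continuous_iff_continuousAt.2 fun t => (hw t).continuousAt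
  have h1 := hasSum_sq_fourierCoeffOn Real.two_pi_pos (memLp_two_of_continuous hwc 0 (2 * π))
  have hu : Continuous fun t => 2 * w' t + τ * I * w t := by fun_prop
  have h2 := hasSum_sq_fourierCoeffOn Real.two_pi_pos (memLp_two_of_continuous hu 0 (2 * π))
  have h3 := hasSum_le (fun n => ?_) h1 h2
  · simp only [sub_zero, smul_eq_mul] at h3
    exact le_of_mul_le_mul_left h3 (by positivity)
  · rw [fourierCoeffOn_add Real.two_pi_pos (by fun_prop) (by fun_prop),
      fourierCoeffOn.const_mul, fourierCoeffOn.const_mul,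
      fourierCoeffOn_deriv_of_periodic hw hc hper]
    rw [show ∀ z : ℂ, 2 * (I * n * z) + τ * I * z = I * (((2 * n + τ : ℝ) : ℂ) * z) by
      intro z; push_cast; ring]
    rw [norm_mul, norm_mul, Complex.norm_I, one_mul, mul_pow, Complex.norm_real,
      Real.norm_eq_abs, sq_abs]
    refine le_mul_of_one_le_left (by positivity) ?_
    have : (1 : ℤ) ≤ (2 * n + 1) ^ 2 ∧ (1 : ℤ) ≤ (2 * n - 1) ^ 2 := by
      constructor <;> · rw [one_le_sq_iff_one_le_abs]; apply Int.one_le_abs; omega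
    rcases hτ with rfl | rfl
    · exact_mod_cast this.1
    · exact_mod_cast this.2

/-- Smooth compactly supported functions on `ℝ³ ∖ {0}`, extended by zero. -/
def testSubmodule : Submodule ℂ (E3 → ℂ) where
  carrier := {g | ContDiff ℝ ∞ g ∧ HasCompactSupport g ∧ g =ᶠ[nhds 0] 0}
  add_mem' := fun ⟨h1, h2, h3⟩ ⟨k1, k2, k3⟩ =>
    ⟨h1.add k1, h2.add k2, by simpa using h3.add k3⟩
  zero_mem' := ⟨contDiff_const, HasCompactSupport.zero, Filter.EventuallyEq.rfl⟩
  smul_mem' := fun c g ⟨h1, h2, h3⟩ =>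
    ⟨contDiff_const.smul h1, h2.smul_left (f := fun _ => c), by
      filter_upwards [h3] with x hx; simp [hx]⟩

/-- Test functions on `ℝ³ ∖ {0}`. -/
abbrev TestFn : Type := testSubmodule

namespace TestFn

instance : CoeFun TestFn fun _ => E3 → ℂ := ⟨Subtype.val⟩

@[ext] lemma ext {g h : TestFn} (H : ∀ x, g x = h x) : g = h := Subtype.ext (funext H)

@[simp] lemma add_apply (g h : TestFn) (x : E3) : (g + h) x = g x + h x := rfl
@[simp] lemma sub_apply (g h : TestFn) (x : E3) : (g - h) x = g x - h x := rfl
@[simp] lemma smul_apply (c : ℂ) (g : TestFn) (x : E3) : (c • g) x = c * g x := rfl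

lemma contDiff (g : TestFn) : ContDiff ℝ ∞ g := g.2.1
lemma differentiable (g : TestFn) : Differentiable ℝ g := g.contDiff.differentiable (by simp)
lemma continuous (g : TestFn) : Continuous g := g.contDiff.continuous
lemma hasCompactSupport (g : TestFn) : HasCompactSupport g := g.2.2.1
lemma eventuallyEq_zero (g : TestFn) : g =ᶠ[nhds 0] 0 := g.2.2.2
lemma integrable (g : TestFn) : Integrable g :=
  g.continuous.integrable_of_hasCompactSupport g.hasCompactSupport
@[simp] lemma apply_zero (g : TestFn) : g 0 = 0 := g.eventuallyEq_zero.eq_of_nhds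

/-- Multiplication by a function which is smooth away from the origin. -/
def mulSmooth (c : E3 → ℂ) (hc : ∀ x ≠ 0, ContDiffAt ℝ ∞ c x) : TestFn →ₗ[ℂ] TestFn where
  toFun g := ⟨fun x => c x * g x, by
      refine contDiff_iff_contDiffAt.2 fun x => ?_
      rcases eq_or_ne x 0 with rfl | hx
      · refine (contDiffAt_const (c := (0 : ℂ))).congr_of_eventuallyEq ?_
        filter_upwards [g.eventuallyEq_zero] with x hx
        simp [hx]
      · exact (hc x hx).mul g.contDiff.contDiffAt,
    g.hasCompactSupport.mul_left, by
      filter_upwards [g.eventuallyEq_zero] with x hx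
      simp [hx]⟩
  map_add' g h := by ext x; exact mul_add _ _ _
  map_smul' a g := by ext x; exact mul_left_comm _ _ _

lemma contDiffAt_conj (g : TestFn) (x : E3) : ContDiffAt ℝ ∞ (fun x => conj (g x)) x :=
  (Complex.conjCLE.contDiff.comp g.contDiff).contDiffAt

/-- The product `conj g * h`. -/
def conjMul (g h : TestFn) : TestFn :=
  mulSmooth (fun x => conj (g x)) (fun x _ => contDiffAt_conj g x) h

/-- The partial derivative `∂_k`. -/
def pderiv (k : Fin 3) : TestFn →ₗ[ℂ] TestFn where
  toFun g := ⟨fun x => fderiv ℝ g x (EuclideanSpace.single k 1),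
    (g.contDiff.fderiv_right (by simp)).clm_apply contDiff_const,
    g.hasCompactSupport.fderiv_apply ℝ _, by
      filter_upwards [g.eventuallyEq_zero.fderiv (𝕜 := ℝ)] with x hx
      simp [hx]⟩
  map_add' g h := by
    ext x
    change fderiv ℝ (fun y => g y + h y) x _ = _
    rw [fderiv_fun_add (g.differentiable x) (h.differentiable x)]
    rfl
  map_smul' a g := by
    ext x
    change fderiv ℝ (fun y => a * g y) x _ = _
    rw [fderiv_const_mul (g.differentiable x)]
    rfl

lemma contDiffAt_coord (k : Fin 3) (x : E3) :
    ContDiffAt ℝ ∞ (fun x : E3 => (x k : ℂ)) x :=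
  (Complex.ofRealCLM.contDiff.comp (EuclideanSpace.proj (𝕜 := ℝ) k).contDiff).contDiffAt

lemma contDiffAt_invNorm (x : E3) (hx : x ≠ 0) :
    ContDiffAt ℝ ∞ (fun x : E3 => ((‖x‖⁻¹ : ℝ) : ℂ)) x :=
  Complex.ofRealCLM.contDiff.contDiffAt.comp x
    ((contDiffAt_norm ℝ hx).inv (norm_ne_zero_iff.2 hx))

/-- Multiplication by the coordinate `x_k`. -/
def coord (k : Fin 3) : TestFn →ₗ[ℂ] TestFn :=
  mulSmooth (fun x => (x k : ℂ)) fun x _ => contDiffAt_coord k x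

/-- Multiplication by `1 / |x|`. -/
def invNorm : TestFn →ₗ[ℂ] TestFn :=
  mulSmooth (fun x => ((‖x‖⁻¹ : ℝ) : ℂ)) contDiffAt_invNorm

@[simp] lemma coord_apply (k : Fin 3) (g : TestFn) (x : E3) : coord k g x = x k * g x := rfl
@[simp] lemma invNorm_apply (g : TestFn) (x : E3) :
    invNorm g x = ((‖x‖⁻¹ : ℝ) : ℂ) * g x := rfl
@[simp] lemma conjMul_apply (g h : TestFn) (x : E3) : conjMul g h x = conj (g x) * h x := rfl
lemma pderiv_apply (k : Fin 3) (g : TestFn) (x : E3) :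
    pderiv k g x = fderiv ℝ g x (EuclideanSpace.single k 1) := rfl

lemma pderiv_comm (j k : Fin 3) (g : TestFn) :
    pderiv j (pderiv k g) = pderiv k (pderiv j g) := by
  ext x
  have h : ∀ j k : Fin 3, pderiv j (pderiv k g) x =
      fderiv ℝ (fderiv ℝ g) x (EuclideanSpace.single j 1) (EuclideanSpace.single k 1) := by
    intro j k
    change fderiv ℝ (fun y => fderiv ℝ g y (EuclideanSpace.single k 1)) x _ = _
    rw [fderiv_clm_apply]
    · simp
    · exact ((g.contDiff.fderiv_right (m := ∞) (by simp)).differentiable (by simp)) x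
    · fun_prop
  rw [h, h]
  exact (g.contDiff.contDiffAt.isSymmSndFDerivAt
    (by simpa using WithTop.coe_le_coe.2 (le_top (a := (2 : ℕ∞))))) _ _

lemma pderiv_mulSmooth (k : Fin 3) (c : E3 → ℂ) (hc : ∀ x ≠ 0, ContDiffAt ℝ ∞ c x)
    (g : TestFn) (x : E3) : pderiv k (mulSmooth c hc g) x =
      fderiv ℝ c x (EuclideanSpace.single k 1) * g x + c x * pderiv k g x := by
  rcases eq_or_ne x 0 with rfl | hx
  · simp
  · change fderiv ℝ (fun y => c y * g y) x _ = _
    rw [fderiv_fun_mul ((hc x hx).differentiableAt (by simp)) (g.differentiable x)]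
    simp [pderiv_apply, mul_comm, add_comm]

lemma pderiv_coord (j k : Fin 3) (g : TestFn) :
    pderiv j (coord k g) = (if j = k then g else 0) + coord k (pderiv j g) := by
  ext x
  have h : HasFDerivAt (fun x : E3 => (x k : ℂ))
      (Complex.ofRealCLM.comp (EuclideanSpace.proj (𝕜 := ℝ) k)) x :=
    Complex.ofRealCLM.hasFDerivAt.comp x (EuclideanSpace.proj (𝕜 := ℝ) k).hasFDerivAt
  rw [coord, pderiv_mulSmooth, h.fderiv]
  split_ifs with hjk
  · subst hjk; simp
    rfl
  · simp [Ne.symm hjk]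
    rfl

lemma pderiv_conjMul (k : Fin 3) (g h : TestFn) :
    pderiv k (conjMul g h) = conjMul (pderiv k g) h + conjMul g (pderiv k h) := by
  ext x
  have hd : HasFDerivAt (fun x : E3 => conj (g x))
      ((Complex.conjCLE : ℂ →L[ℝ] ℂ).comp (fderiv ℝ g x)) x :=
    Complex.conjCLE.hasFDerivAt.comp x (g.differentiable x).hasFDerivAt
  rw [conjMul, pderiv_mulSmooth, hd.fderiv]
  rfl

lemma pderiv_invNorm (k : Fin 3) (g : TestFn) :
    pderiv k (invNorm g) =
      invNorm (pderiv k g) - coord k (invNorm (invNorm (invNorm g))) := by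
  ext x
  rcases eq_or_ne x 0 with rfl | hx
  · simp
  have h0 : ‖x‖ ≠ 0 := norm_ne_zero_iff.2 hx
  have h1 : HasFDerivAt (fun y : E3 => ‖y‖) (‖x‖⁻¹ • innerSL ℝ x) x := by
    have := (hasStrictFDerivAt_norm_sq x).hasFDerivAt.sqrt (by positivity)
    simp only [Real.sqrt_sq (norm_nonneg _)] at this
    have h2 : ‖x‖⁻¹ • innerSL ℝ x = (1 / (2 * ‖x‖)) • 2 • innerSL ℝ x := by
      rw [← Nat.cast_smul_eq_nsmul ℝ, smul_smul]
      congr 1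
      push_cast
      field_simp
    rwa [h2]
  have h : HasFDerivAt (fun x : E3 => ((‖x‖⁻¹ : ℝ) : ℂ))
      (Complex.ofRealCLM.comp ((-(‖x‖ ^ 2)⁻¹) • (‖x‖⁻¹ • innerSL ℝ x))) x :=
    Complex.ofRealCLM.hasFDerivAt.comp x ((hasDerivAt_inv h0).comp_hasFDerivAt x h1)
  rw [invNorm, pderiv_mulSmooth, h.fderiv]
  simp [EuclideanSpace.inner_single_right, mulSmooth, coord]
  have h0' : (‖x‖ : ℂ) ≠ 0 := by exact_mod_cast h0
  field_simp
  ring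

lemma integral_pderiv (k : Fin 3) (g : TestFn) : ∫ x, pderiv k g x = 0 := by
  have h : Integrable fun x => fderiv ℝ g x (EuclideanSpace.single k 1) := (pderiv k g).integrable
  have := integral_mul_fderiv_eq_neg_fderiv_mul_of_integrable (𝕜 := ℂ) (μ := (volume : Measure E3))
    (f := fun _ => 1) (g := g) (v := EuclideanSpace.single k 1) (by simp)
    (by simpa using h) (by simpa using g.integrable)
    (fun _ _ => by fun_prop) (fun x _ => g.differentiable x)
  simp only [one_mul, fderiv_fun_const, Pi.zero_apply, _root_.zero_apply, zero_mul, integral_zero,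
    neg_zero] at this
  exact this

/-- The inner product of `L²(ℝ³, dx / |x|)`. -/
def ip : TestFn →ₗ⋆[ℂ] TestFn →ₗ[ℂ] ℂ :=
  LinearMap.mk₂'ₛₗ (starRingEnd ℂ) (RingHom.id ℂ) (fun g h => ∫ x, invNorm (conjMul g h) x)
    (fun g g' h => by
      rw [← integral_add (integrable _) (integrable _)]
      congr 1 with x
      simp; ring)
    (fun c g h => by
      rw [smul_eq_mul, ← integral_const_mul]
      congr 1 with x
      simp; ring)
    (fun g h h' => by
      rw [← integral_add (integrable _) (integrable _)]
      congr 1 with x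
      simp; ring)
    (fun c g h => by
      rw [smul_eq_mul, ← integral_const_mul]
      congr 1 with x
      simp; ring)

lemma ip_def (g h : TestFn) : ip g h = ∫ x, invNorm (conjMul g h) x := rfl

lemma conj_ip (g h : TestFn) : conj (ip g h) = ip h g := by
  rw [ip_def, ip_def, ← integral_conj]
  congr 1 with x
  simp [mul_comm]

lemma ip_self (g : TestFn) : ip g g = ((∫ x, ‖x‖⁻¹ * ‖g x‖ ^ 2 : ℝ) : ℂ) := by
  rw [ip_def, ← integral_complex_ofReal]
  congr 1 with x
  simp [Complex.conj_mul']

lemma re_ip_self_nonneg (g : TestFn) : 0 ≤ (ip g g).re := by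
  rw [ip_self, Complex.ofReal_re]
  positivity

lemma ip_coord (k : Fin 3) (g h : TestFn) : ip (coord k g) h = ip g (coord k h) := by
  rw [ip_def, ip_def]
  congr 1 with x
  simp only [invNorm_apply, conjMul_apply, coord_apply, map_mul, Complex.conj_ofReal]
  ring

lemma ip_pderiv (k : Fin 3) (g h : TestFn) : ip (pderiv k g) h =
    -ip g (pderiv k h) + ip g (coord k (invNorm (invNorm h))) := by
  have h0 := integral_pderiv k (invNorm (conjMul g h))
  rw [pderiv_invNorm, pderiv_conjMul, map_add] at h0
  have h1 : ∀ x, (invNorm (conjMul (pderiv k g) h) + invNorm (conjMul g (pderiv k h)) -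
      coord k (invNorm (invNorm (invNorm (conjMul g h)))) : TestFn) x =
      (invNorm (conjMul (pderiv k g) h) x + invNorm (conjMul g (pderiv k h)) x) -
      invNorm (conjMul g (coord k (invNorm (invNorm h)))) x := by
    intro x
    simp only [add_apply, sub_apply, invNorm_apply, conjMul_apply, coord_apply]
    ring
  simp_rw [h1] at h0
  rw [integral_sub (.fun_add (integrable _) (integrable _)) (integrable _),
    integral_add (integrable _) (integrable _)] at h0
  rw [ip_def, ip_def, ip_def]
  linear_combination h0

lemma coord_comm (j k : Fin 3) (g : TestFn) : coord j (coord k g) = coord k (coord j g) := by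
  ext x; simp; ring

lemma coord_invNorm (k : Fin 3) (g : TestFn) : coord k (invNorm g) = invNorm (coord k g) := by
  ext x; simp; ring

lemma coord_sq_invNorm_sq (g : TestFn) :
    coord 0 (coord 0 (invNorm (invNorm g))) + coord 1 (coord 1 (invNorm (invNorm g))) +
      coord 2 (coord 2 (invNorm (invNorm g))) = g := by
  ext x
  rcases eq_or_ne x 0 with rfl | hx
  · simp
  have h0 : (‖x‖ : ℂ) ≠ 0 := by exact_mod_cast norm_ne_zero_iff.2 hx
  have h1 : (‖x‖ : ℂ) ^ 2 = x 0 ^ 2 + x 1 ^ 2 + x 2 ^ 2 := by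
    have := EuclideanSpace.real_norm_sq_eq x
    rw [Fin.sum_univ_three] at this
    exact_mod_cast this
  simp
  field_simp
  rw [h1]
  ring

/-- The generator `x_j ∂_k - x_k ∂_j` of rotations. -/
def rot (j k : Fin 3) : TestFn →ₗ[ℂ] TestFn := coord j ∘ₗ pderiv k - coord k ∘ₗ pderiv j

/-- The Euler operator `x · ∇`. -/
def euler : TestFn →ₗ[ℂ] TestFn :=
  coord 0 ∘ₗ pderiv 0 + coord 1 ∘ₗ pderiv 1 + coord 2 ∘ₗ pderiv 2

lemma rot_apply (j k : Fin 3) (g : TestFn) :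
    rot j k g = coord j (pderiv k g) - coord k (pderiv j g) := rfl

lemma euler_apply (g : TestFn) :
    euler g = coord 0 (pderiv 0 g) + coord 1 (pderiv 1 g) + coord 2 (pderiv 2 g) := rfl

lemma ip_rot {j k : Fin 3} (hjk : j ≠ k) (g h : TestFn) :
    ip (rot j k g) h = -ip g (rot j k h) := by
  simp only [rot_apply, map_sub, LinearMap.sub_apply, ip_coord, ip_pderiv, pderiv_coord, hjk,
    hjk.symm, if_false, zero_add, ← coord_invNorm]
  rw [coord_comm j k]
  ring

lemma ip_euler (g h : TestFn) : ip (euler g) h = -ip g (euler h) - 2 * ip g h := by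
  have h1 := congrArg (ip g) (coord_sq_invNorm_sq h)
  simp only [euler_apply, map_add, LinearMap.add_apply, ip_coord, ip_pderiv, pderiv_coord,
    if_true, ← coord_invNorm] at h1 ⊢
  linear_combination h1

lemma euler_rot (j k : Fin 3) (g : TestFn) : euler (rot j k g) = rot j k (euler g) := by
  ext x
  fin_cases j <;> fin_cases k <;>
  · simp [euler_apply, rot_apply, pderiv_coord, pderiv_comm 1 0, pderiv_comm 2 0,
      pderiv_comm 2 1]
    try ring

lemma rot_rot {i j k : Fin 3} (hij : i ≠ j) (hjk : j ≠ k) (hki : k ≠ i) (g : TestFn) :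
    rot j k (rot k i g) = rot k i (rot j k g) - rot i j g := by
  ext x
  simp [rot_apply, pderiv_coord, hij, hij.symm, hjk, hjk.symm, hki, hki.symm]
  rw [pderiv_comm k j, pderiv_comm i k, pderiv_comm i j]
  ring

/-- The rotation by the angle `θ` in the oriented `(j, k)`-plane. -/
def rotation (j k : Fin 3) (θ : ℝ) (x : E3) : E3 :=
  x + (Real.cos θ - 1) • (EuclideanSpace.single j (x j) + EuclideanSpace.single k (x k)) +
    Real.sin θ • (EuclideanSpace.single k (x j) - EuclideanSpace.single j (x k))

lemma norm_rotation {j k : Fin 3} (hjk : j ≠ k) (θ : ℝ) (x : E3) : ‖rotation j k θ x‖ = ‖x‖ := by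
  rw [← sq_eq_sq₀ (norm_nonneg _) (norm_nonneg _), EuclideanSpace.real_norm_sq_eq,
    EuclideanSpace.real_norm_sq_eq, Fin.sum_univ_three, Fin.sum_univ_three]
  have h := Real.sin_sq_add_cos_sq θ
  fin_cases j <;> fin_cases k <;> first | exact absurd rfl hjk | skip
  · simp [rotation]; linear_combination (x 0 ^ 2 + x 1 ^ 2) * h
  · simp [rotation]; linear_combination (x 0 ^ 2 + x 2 ^ 2) * h
  · simp [rotation]; linear_combination (x 0 ^ 2 + x 1 ^ 2) * h
  · simp [rotation]; linear_combination (x 1 ^ 2 + x 2 ^ 2) * h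
  · simp [rotation]; linear_combination (x 0 ^ 2 + x 2 ^ 2) * h
  · simp [rotation]; linear_combination (x 1 ^ 2 + x 2 ^ 2) * h

lemma measurePreserving_rotation {j k : Fin 3} (hjk : j ≠ k) (θ : ℝ) :
    MeasurePreserving (rotation j k θ) := by
  let f : E3 →ₗᵢ[ℝ] E3 :=
    { toFun := rotation j k θ
      map_add' := fun x y => by ext i; simp [rotation]; split_ifs <;> ring
      map_smul' := fun c x => by ext i; simp [rotation]; split_ifs <;> ring
      norm_map' := norm_rotation hjk θ }
  exact (f.toLinearIsometryEquiv rfl).measurePreserving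

lemma continuous_rotation (j k : Fin 3) :
    Continuous fun p : ℝ × E3 => rotation j k p.1 p.2 := by
  have h : ∀ i l : Fin 3, Continuous fun p : ℝ × E3 => EuclideanSpace.single i (p.2 l) := by
    intro i l
    have : (fun p : ℝ × E3 => EuclideanSpace.single i (p.2 l)) =
        fun p => p.2 l • EuclideanSpace.single i (1 : ℝ) := by
      ext p; simp
    rw [this]
    fun_prop
  unfold rotation
  have := h j j
  have := h j k
  have := h k j
  have := h k k
  fun_prop

lemma hasDerivAt_rotation {j k : Fin 3} (hjk : j ≠ k) (x : E3) (θ : ℝ) :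
    HasDerivAt (fun θ => rotation j k θ x)
      (rotation j k θ x j • EuclideanSpace.single k 1 -
        rotation j k θ x k • EuclideanSpace.single j 1) θ := by
  have h := (((Real.hasDerivAt_cos θ).sub_const 1).smul_const
    (EuclideanSpace.single j (x j) + EuclideanSpace.single k (x k))).const_add x |>.add
    ((Real.hasDerivAt_sin θ).smul_const
    (EuclideanSpace.single k (x j) - EuclideanSpace.single j (x k)))
  refine h.congr_deriv ?_
  ext i
  by_cases hi : i = j
  · subst hi
    simp [rotation, hjk, hjk.symm]
    ring
  · by_cases hi' : i = k
    · subst hi'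
      simp [rotation, hjk, hjk.symm]
      ring
    · simp [hi, hi']

lemma hasDerivAt_comp_rotation {j k : Fin 3} (hjk : j ≠ k) (g : TestFn) (x : E3) (θ : ℝ) :
    HasDerivAt (fun θ => g (rotation j k θ x)) (rot j k g (rotation j k θ x)) θ := by
  have h := (g.differentiable (rotation j k θ x)).hasFDerivAt.comp_hasDerivAt θ
    (hasDerivAt_rotation hjk x θ)
  refine h.congr_deriv ?_
  simp [rot_apply, pderiv_apply]

lemma integral_nonneg_of_rotation {j k : Fin 3} (hjk : j ≠ k) {H : E3 → ℝ} (hH : Integrable H)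
    (h : ∀ x, 0 ≤ ∫ θ in (0 : ℝ)..2 * π, H (rotation j k θ x)) : 0 ≤ ∫ x, H x := by
  have hmp : MeasurePreserving (fun p : ℝ × E3 => (p.1, rotation j k p.1 p.2))
      ((volume.restrict (Set.Ioc 0 (2 * π))).prod volume)
      ((volume.restrict (Set.Ioc 0 (2 * π))).prod volume) :=
    (MeasurePreserving.id _).skew_product (g := fun θ x => rotation j k θ x)
      (continuous_rotation j k).measurable
      (.of_forall fun θ => (measurePreserving_rotation hjk θ).map_eq)
  have hint : Integrable (Function.uncurry fun (θ : ℝ) x => H (rotation j k θ x))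
      ((volume.restrict (Set.Ioc 0 (2 * π))).prod volume) :=
    hmp.integrable_comp_of_integrable (hH.comp_snd _)
  have hswap := integral_integral_swap hint
  have hrot : ∀ θ, ∫ x, H (rotation j k θ x) = ∫ x, H x := fun θ => by
    have hm := measurePreserving_rotation hjk θ
    have h1 := integral_map (f := H) hm.aemeasurable (by
      rw [hm.map_eq]; exact hH.aestronglyMeasurable)
    rw [hm.map_eq] at h1
    exact h1.symm
  simp only [hrot] at hswap
  rw [integral_const, smul_eq_mul] at hswap
  refine nonneg_of_mul_nonneg_right (a := 2 * π) ?_ Real.two_pi_pos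
  have hvol : (volume.restrict (Set.Ioc 0 (2 * π))).real Set.univ = 2 * π := by
    simp [Measure.real, Real.pi_pos.le]
  rw [hvol] at hswap
  rw [hswap]
  refine integral_nonneg fun x => ?_
  have := h x
  rwa [intervalIntegral.integral_of_le Real.two_pi_pos.le] at this

lemma integrable_norm_inv_mul_sq (f : TestFn) : Integrable fun x => ‖x‖⁻¹ * ‖f x‖ ^ 2 := by
  refine (invNorm (conjMul f f)).integrable.re.congr (.of_forall fun x => ?_)
  simp only [invNorm_apply, conjMul_apply, Complex.conj_mul']
  norm_cast

lemma re_ip_self_le_rot {j k : Fin 3} (hjk : j ≠ k) {τ : ℝ} (hτ : τ = 1 ∨ τ = -1) (g : TestFn) :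
    (ip g g).re ≤ (ip ((2 : ℂ) • rot j k g + (τ * I) • g)
      ((2 : ℂ) • rot j k g + (τ * I) • g)).re := by
  set f : TestFn := (2 : ℂ) • rot j k g + (τ * I) • g with hf
  rw [ip_self, ip_self, Complex.ofReal_re, Complex.ofReal_re, ← sub_nonneg,
    ← integral_sub (integrable_norm_inv_mul_sq _) (integrable_norm_inv_mul_sq _)]
  refine integral_nonneg_of_rotation hjk
    ((integrable_norm_inv_mul_sq _).sub (integrable_norm_inv_mul_sq _)) fun x => ?_
  have hr : Continuous fun θ => rotation j k θ x :=
    (continuous_rotation j k).comp (by fun_prop : Continuous fun θ : ℝ => (θ, x))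
  have hper : rotation j k (2 * π) x = rotation j k 0 x := by simp [rotation]
  have hw := integral_sq_le_of_periodic (fun θ => hasDerivAt_comp_rotation hjk g x θ)
    ((rot j k g).continuous.comp hr) (by rw [hper]) hτ
  have hg' : Continuous fun θ => ‖g (rotation j k θ x)‖ ^ 2 :=
    (g.continuous.comp hr).norm.pow 2
  have hf' : Continuous fun θ => ‖f (rotation j k θ x)‖ ^ 2 :=
    (f.continuous.comp hr).norm.pow 2
  simp only [norm_rotation hjk, ← mul_sub]
  rw [intervalIntegral.integral_const_mul, intervalIntegral.integral_sub
    (hf'.intervalIntegrable _ _) (hg'.intervalIntegrable _ _)]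
  exact mul_nonneg (by positivity) (sub_nonneg.2 hw)

end TestFn

open TestFn

/-- Two-component spinors. -/
abbrev Spinor : Type := TestFn × TestFn

namespace Spinor

/-- The inner product of two-component spinors in `L²(ℝ³, dx / |x|)`. -/
def ipS (φ χ : Spinor) : ℂ := ip φ.1 χ.1 + ip φ.2 χ.2

/-- The operator `1 + σ · L` with `L = -i x × ∇`. -/
def angular (φ : Spinor) : Spinor :=
  (φ.1 - I • rot 0 1 φ.1 - I • rot 1 2 φ.2 - rot 2 0 φ.2,
    φ.2 + I • rot 0 1 φ.2 - I • rot 1 2 φ.1 + rot 2 0 φ.1)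

/-- The operator `x · ∇ + 1`. -/
def radial (φ : Spinor) : Spinor := (euler φ.1 + φ.1, euler φ.2 + φ.2)

/-- The operator `σ · x`. -/
def sigmaX (φ : Spinor) : Spinor :=
  (coord 2 φ.1 + coord 0 φ.2 - I • coord 1 φ.2, coord 0 φ.1 + I • coord 1 φ.1 - coord 2 φ.2)

lemma conj_ipS (φ χ : Spinor) : conj (ipS φ χ) = ipS χ φ := by
  simp [ipS, conj_ip]

lemma ipS_angular (φ χ : Spinor) : ipS (angular φ) χ = ipS φ (angular χ) := by
  simp [ipS, angular, ip_rot]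
  ring

lemma ipS_radial (φ χ : Spinor) : ipS (radial φ) χ = -ipS φ (radial χ) := by
  simp [ipS, radial, ip_euler]
  ring

lemma ipS_sigmaX (φ χ : Spinor) : ipS (sigmaX φ) χ = ipS φ (sigmaX χ) := by
  simp [ipS, sigmaX, ip_coord]
  ring

lemma radial_angular (φ : Spinor) : radial (angular φ) = angular (radial φ) := by
  ext x <;> simp [radial, angular, euler_rot] <;> ring

lemma angular_sigmaX (φ : Spinor) : angular (sigmaX φ) = -sigmaX (angular φ) := by
  ext x <;> simp [sigmaX, angular, rot_apply, pderiv_coord]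
  · ring_nf; simp; ring
  · ring_nf; simp

lemma re_ipS_radial_angular (φ : Spinor) : (ipS (radial φ) (angular φ)).re = 0 := by
  have h : ipS (radial φ) (angular φ) = -conj (ipS (radial φ) (angular φ)) := by
    rw [conj_ipS, ipS_angular, ← radial_angular, ipS_radial]
  have := congrArg Complex.re h
  simp at this
  linarith

lemma ipS_sigmaX_angular (φ χ : Spinor) :
    ipS (sigmaX χ) (angular φ) = -conj (ipS (sigmaX φ) (angular χ)) := by
  rw [conj_ipS, ipS_sigmaX, ipS_angular χ, angular_sigmaX]
  simp [ipS]
  ring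

lemma re_ipS_self_le_angular (φ : Spinor) :
    (ipS φ φ).re ≤ (ipS (angular φ) (angular φ)).re := by
  have h1 := re_ip_self_le_rot (j := 0) (k := 1) (by decide) (.inl rfl) φ.1
  have h2 := re_ip_self_le_rot (j := 0) (k := 1) (by decide) (.inr rfl) φ.2
  have h3 := re_ip_self_le_rot (j := 1) (k := 2) (by decide) (.inl rfl) (φ.1 + φ.2)
  have h4 := re_ip_self_le_rot (j := 1) (k := 2) (by decide) (.inr rfl) (φ.1 - φ.2)
  have h5 := re_ip_self_le_rot (j := 2) (k := 0) (by decide) (.inl rfl) (φ.1 - I • φ.2)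
  have h6 := re_ip_self_le_rot (j := 2) (k := 0) (by decide) (.inr rfl) (φ.1 + I • φ.2)
  have r1 : ∀ g, rot 1 2 (rot 2 0 g) = rot 2 0 (rot 1 2 g) - rot 0 1 g :=
    rot_rot (by decide) (by decide) (by decide)
  have r2 : ∀ g, rot 2 0 (rot 0 1 g) = rot 0 1 (rot 2 0 g) - rot 1 2 g :=
    rot_rot (by decide) (by decide) (by decide)
  have r3 : ∀ g, rot 0 1 (rot 1 2 g) = rot 1 2 (rot 0 1 g) - rot 2 0 g :=
    rot_rot (by decide) (by decide) (by decide)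
  have e1 : (0 : Fin 3) ≠ 1 := by decide
  have e2 : (1 : Fin 3) ≠ 2 := by decide
  have e3 : (2 : Fin 3) ≠ 0 := by decide
  rcases φ with ⟨a, b⟩
  simp [ipS, angular, ip_rot e1, ip_rot e2, ip_rot e3, r1, r2, r3] at *
  linarith

/-- The operator `σ · ∇`. -/
def sigmaD (φ : Spinor) : Spinor :=
  (pderiv 2 φ.1 + pderiv 0 φ.2 - I • pderiv 1 φ.2, pderiv 0 φ.1 + I • pderiv 1 φ.1 - pderiv 2 φ.2)

lemma sigmaX_sigmaD (φ χ : Spinor) (c : ℂ) :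
    sigmaX (I • sigmaD φ + c • χ) = I • (radial φ + (-I * c) • sigmaX χ - angular φ) := by
  ext x <;> simp [sigmaX, sigmaD, radial, angular, euler_apply, rot_apply]
  · ring_nf; simp; ring
  · ring_nf; simp; ring

lemma re_ipS_self_nonneg (φ : Spinor) : 0 ≤ (ipS φ φ).re := by
  rw [ipS, Complex.add_re]
  exact add_nonneg (re_ip_self_nonneg _) (re_ip_self_nonneg _)

lemma re_ipS_self_sub_le (φ χ : Spinor) (c : ℂ) :
    (ipS φ φ).re - 2 * (I * conj c * ipS (sigmaX χ) (angular φ)).re ≤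
      (ipS (sigmaX (I • sigmaD φ + c • χ)) (sigmaX (I • sigmaD φ + c • χ))).re := by
  have hsub : ∀ u v : Spinor, (ipS (I • (u - v)) (I • (u - v))).re =
      (ipS u u).re + (ipS v v).re - 2 * (ipS u v).re := by
    intro u v
    have h := congrArg Complex.re (conj_ipS u v)
    simp [ipS] at h ⊢
    linarith
  rw [sigmaX_sigmaD, hsub]
  have h1 : ipS (radial φ + (-I * c) • sigmaX χ) (angular φ) =
      ipS (radial φ) (angular φ) + I * conj c * ipS (sigmaX χ) (angular φ) := by
    simp [ipS]
    ring
  rw [h1, Complex.add_re, re_ipS_radial_angular]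
  have := re_ipS_self_nonneg (radial φ + (-I * c) • sigmaX χ)
  have := re_ipS_self_le_angular φ
  linarith

/-- The Hardy–Dirac inequality in terms of the upper and lower spinors. -/
lemma hardy_dirac (φ χ : Spinor) (c : ℂ) :
    (ipS φ φ).re + (ipS χ χ).re ≤
      (ipS (sigmaX (I • sigmaD χ + (-conj c) • φ)) (sigmaX (I • sigmaD χ + (-conj c) • φ))).re +
      (ipS (sigmaX (I • sigmaD φ + c • χ)) (sigmaX (I • sigmaD φ + c • χ))).re := by
  have h1 := re_ipS_self_sub_le φ χ c
  have h2 := re_ipS_self_sub_le χ φ (-conj c)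
  rw [ipS_sigmaX_angular] at h1
  simp at h1 h2 ⊢
  linarith

lemma integrable_spinor (φ : Spinor) :
    Integrable fun x => (‖φ.1 x‖ ^ 2 + ‖φ.2 x‖ ^ 2) / ‖x‖ :=
  ((integrable_norm_inv_mul_sq φ.1).add (integrable_norm_inv_mul_sq φ.2)).congr
    (.of_forall fun x => by simp only [Pi.add_apply]; ring)

lemma re_ipS_self (φ : Spinor) :
    (ipS φ φ).re = ∫ x, (‖φ.1 x‖ ^ 2 + ‖φ.2 x‖ ^ 2) / ‖x‖ := by
  rw [ipS, Complex.add_re, ip_self, ip_self, Complex.ofReal_re, Complex.ofReal_re,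
    ← integral_add (integrable_norm_inv_mul_sq _) (integrable_norm_inv_mul_sq _)]
  congr 1 with x
  ring

lemma norm_sq_sigmaX (φ : Spinor) (x : E3) :
    ‖(sigmaX φ).1 x‖ ^ 2 + ‖(sigmaX φ).2 x‖ ^ 2 =
      ‖x‖ ^ 2 * (‖φ.1 x‖ ^ 2 + ‖φ.2 x‖ ^ 2) := by
  rw [EuclideanSpace.real_norm_sq_eq, Fin.sum_univ_three]
  simp [sigmaX, Complex.sq_norm, Complex.normSq_apply]
  ring

lemma re_ipS_sigmaX_self (φ : Spinor) :
    (ipS (sigmaX φ) (sigmaX φ)).re = ∫ x, ‖x‖ * (‖φ.1 x‖ ^ 2 + ‖φ.2 x‖ ^ 2) := by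
  rw [re_ipS_self]
  congr 1 with x
  rw [norm_sq_sigmaX]
  rcases eq_or_ne x 0 with rfl | hx
  · simp
  · have := norm_ne_zero_iff.2 hx
    field_simp

lemma integrable_sigmaX (φ : Spinor) :
    Integrable fun x => ‖x‖ * (‖φ.1 x‖ ^ 2 + ‖φ.2 x‖ ^ 2) := by
  refine ((integrable_norm_inv_mul_sq (sigmaX φ).1).add
    (integrable_norm_inv_mul_sq (sigmaX φ).2)).congr (.of_forall fun x => ?_)
  simp only [Pi.add_apply, ← mul_add, norm_sq_sigmaX]
  rcases eq_or_ne x 0 with rfl | hx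
  · simp
  · have := norm_ne_zero_iff.2 hx
    field_simp

end Spinor

lemma finSumFinEquiv_symm_two_two :
    (finSumFinEquiv.symm : Fin (2 + 2) → Fin 2 ⊕ Fin 2) = ![.inl 0, .inl 1, .inr 0, .inr 1] := by
  funext i
  fin_cases i <;> rfl

lemma diracAlpha_mulVec (k : Fin 3) (v : Fin 4 → ℂ) : (diracAlpha k).mulVec v =
    ![pauli k 0 0 * v 2 + pauli k 0 1 * v 3, pauli k 1 0 * v 2 + pauli k 1 1 * v 3,
      pauli k 0 0 * v 0 + pauli k 0 1 * v 1, pauli k 1 0 * v 0 + pauli k 1 1 * v 1] := by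
  ext i
  fin_cases i <;>
  simp [Matrix.mulVec, dotProduct, Fin.sum_univ_four, diracAlpha, finSumFinEquiv_symm_two_two]

lemma diracBeta_mulVec (v : Fin 4 → ℂ) : diracBeta.mulVec v = ![v 0, v 1, -v 2, -v 3] := by
  ext i
  fin_cases i <;>
  simp [Matrix.mulVec, dotProduct, Fin.sum_univ_four, diracBeta, finSumFinEquiv_symm_two_two]

lemma alphaGrad_eq (ψ : E3 → Fin 4 → ℂ) (x : E3) :
    let d := fun k : Fin 3 => fderiv ℝ ψ x (EuclideanSpace.single k 1)
    alphaGrad ψ x = ![d 2 2 + d 0 3 - I * d 1 3, d 0 2 + I * d 1 2 - d 2 3,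
      d 2 0 + d 0 1 - I * d 1 1, d 0 0 + I * d 1 0 - d 2 1] := by
  ext i
  fin_cases i <;> simp [alphaGrad, Fin.sum_univ_three, diracAlpha_mulVec, pauli] <;> ring

/-- The component of a spinor field supported away from the origin, as a test function. -/
def TestFn.ofComponent {ψ : E3 → Fin 4 → ℂ} (hψ : ContDiff ℝ (⊤ : ℕ∞) ψ)
    (hc : HasCompactSupport ψ) (h0 : (0 : E3) ∉ tsupport ψ) (i : Fin 4) : TestFn :=
  ⟨fun x => ψ x i, contDiff_pi.1 hψ i, hc.comp_left (g := fun v : Fin 4 → ℂ => v i) rfl, by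
    filter_upwards [notMem_tsupport_iff_eventuallyEq.1 h0] with x hx
    simp [hx]⟩

end HardyDirac

open HardyDirac Spinor TestFn in
theorem stmt12 (ψ : E3 → Fin 4 → ℂ) (hψ : ContDiff ℝ (⊤ : ℕ∞) ψ) (hc : HasCompactSupport ψ)
    (h0 : (0 : E3) ∉ tsupport ψ) (m : ℝ) (hm : 0 ≤ m) (ε : ℝ) (hε : 0 < ε)
    (s : ℝ) (hs : s = 1 ∨ s = -1) :
    (∫ x : E3, (∑ i, ‖ψ x i‖ ^ 2) / ‖x‖) ≤
      ∫ x : E3, ‖x‖ * ∑ i,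
        ‖Complex.I * alphaGrad ψ x i - (m : ℂ) * diracBeta.mulVec (ψ x) i +
          ((s * ε : ℝ) : ℂ) * Complex.I * ψ x i‖ ^ 2 := by
  set p : Fin 4 → TestFn := ofComponent hψ hc h0 with hp
  have hpx : ∀ i x, p i x = ψ x i := fun _ _ => rfl
  have hd : ∀ i k x, fderiv ℝ ψ x (EuclideanSpace.single k 1) i = pderiv k (p i) x := by
    intro i k x
    have h := hasFDerivAt_pi'.1 ((hψ.differentiable (by simp)) x).hasFDerivAt i
    exact (congrArg (fun L => L (EuclideanSpace.single k 1)) h.fderiv).symm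
  set c : ℂ := m + Complex.I * (s * ε : ℝ)
  have key := hardy_dirac (p 0, p 1) (p 2, p 3) c
  rw [re_ipS_self, re_ipS_self, re_ipS_sigmaX_self, re_ipS_sigmaX_self,
    ← integral_add (integrable_spinor _) (integrable_spinor _),
    ← integral_add (integrable_sigmaX _) (integrable_sigmaX _)] at key
  convert key using 1
  · congr 1 with x
    simp only [Fin.sum_univ_four, hpx]
    ring
  · congr 1 with x
    rw [← mul_add, Fin.sum_univ_four]
    simp only [alphaGrad_eq, diracBeta_mulVec, hd, ← hpx]
    simp [sigmaD, c]
    exact .inl (by ring_nf)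
end
end
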